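/- For a median algebra X the following are equivalent: (i) every family of pairwise crossing halfspaces of X is finite (X has subinfinite rank); (ii) there is no infinite sequence (A_n)_{n∈ℕ} of halfspaces of X such that every finite subfamily of {A_n : n ∈ ℕ} is an independent family of sets (equivalently, the family of characteristic functions of halfspaces of X contains no infinite independent sequence). -/

import Mathlib

open Set

/-- A median algebra: a ternary operation invariant under permutations of its
arguments, with `m x y y = y` and the standard associativity law. -/
structure MedianStruct (X : Type*) where
  med : X → X → X → X
  med_perm : ∀ (σ : Equiv.Perm (Fin 3)) (v : Fin 3 → X),
    med (v (σ 0)) (v (σ 1)) (v (σ 2)) = med (v 0) (v 1) (v 2)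
  med_idem : ∀ x y : X, med x y y = y
  med_assoc : ∀ x y z u w : X,
    med (med x y z) u w = med x (med y u w) (med z u w)

namespace MedianStruct

variable {X : Type*}

/-- The interval `[x,y] = {z | m x y z = z}`. -/
def interval (M : MedianStruct X) (x y : X) : Set X := {z | M.med x y z = z}

/-- A set is convex if it contains the interval between any two of its points. -/
def IsConvex (M : MedianStruct X) (C : Set X) : Prop :=
  ∀ x ∈ C, ∀ y ∈ C, M.interval x y ⊆ C

/-- A halfspace: a convex set with convex complement. -/
def IsHalfspace (M : MedianStruct X) (H : Set X) : Prop :=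
  M.IsConvex H ∧ M.IsConvex Hᶜ

end MedianStruct

/-- Two sets are crossing if all four intersections of them/their complements
are nonempty. -/
def Crossing {X : Type*} (A B : Set X) : Prop :=
  (A ∩ B).Nonempty ∧ (A ∩ Bᶜ).Nonempty ∧ (Aᶜ ∩ B).Nonempty ∧ (Aᶜ ∩ Bᶜ).Nonempty

/-- A finite family of sets is (Rosenthal) independent. -/
def IndepSetFamily {X : Type*} {k : ℕ} (A : Fin k → Set X) : Prop :=
  ∀ P M : Finset (Fin k), Disjoint P M →
    ((⋂ i ∈ P, A i) ∩ ⋂ j ∈ M, (A j)ᶜ).Nonempty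

/-- The independence number of a family of sets: the supremum of the sizes of
independent finite subfamilies. -/
noncomputable def indSets {X : Type*} (𝒞 : Set (Set X)) : ℕ∞ :=
  ⨆ (k : ℕ) (_ : ∃ A : Fin k → Set X,
      (∀ i, A i ∈ 𝒞) ∧ Function.Injective A ∧ IndepSetFamily A), (k : ℕ∞)

/-- Majority (median) operation on `Bool`. -/
def boolMed (a b c : Bool) : Bool := (a && b) || (b && c) || (a && c)

/-- The coordinatewise majority median on a power of `Bool`. -/
def boolCubeMed (I : Type*) : MedianStruct (I → Bool) where
  med x y z := fun i => boolMed (x i) (y i) (z i)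
  med_perm σ v := by
    funext i
    exact (by decide :
      ∀ (τ : Equiv.Perm (Fin 3)) (w : Fin 3 → Bool),
        boolMed (w (τ 0)) (w (τ 1)) (w (τ 2)) = boolMed (w 0) (w 1) (w 2))
      σ (fun j => v j i)
  med_idem x y := by
    funext i
    exact (by decide : ∀ a b : Bool, boolMed a b b = b) (x i) (y i)
  med_assoc x y z u w := by
    funext i
    exact (by decide : ∀ a b c d e : Bool,
        boolMed (boolMed a b c) d e = boolMed a (boolMed b d e) (boolMed c d e))
      (x i) (y i) (z i) (u i) (w i)

/-- A median-preserving (MP) map between median algebras. -/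
def IsMedianHom {X Y : Type*} (M : MedianStruct X) (N : MedianStruct Y)
    (f : X → Y) : Prop :=
  ∀ x y z, f (M.med x y z) = N.med (f x) (f y) (f z)

/-- The rank of a median algebra: the supremum of the `n` such that the Boolean
hypercube `{0,1}ⁿ` embeds into it by an injective median-preserving map. -/
noncomputable def medRank {X : Type*} (M : MedianStruct X) : ℕ∞ :=
  ⨆ (n : ℕ) (_ : ∃ f : (Fin n → Bool) → X,
      Function.Injective f ∧ IsMedianHom (boolCubeMed (Fin n)) M f), (n : ℕ∞)

/-- The median operation on `ℝ`. -/
noncomputable def realMed (a b c : ℝ) : ℝ := max (max (min a b) (min b c)) (min a c)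

/-- A real-valued median-preserving function on a median algebra. -/
def IsMedianPreserving {X : Type*} (M : MedianStruct X) (f : X → ℝ) : Prop :=
  ∀ x y z, f (M.med x y z) = realMed (f x) (f y) (f z)

/-- A finite sequence of real functions is independent with witnessing
constants `a < b`. -/
def IndepFunFinWith {X : Type*} {k : ℕ} (f : Fin k → X → ℝ) (a b : ℝ) : Prop :=
  ∀ P M : Finset (Fin k), Disjoint P M →
    ((⋂ i ∈ P, {x | f i x ≤ a}) ∩ ⋂ j ∈ M, {x | b ≤ f j x}).Nonempty

/-- A finite sequence of real functions is independent. -/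
def IndepFunFin {X : Type*} {k : ℕ} (f : Fin k → X → ℝ) : Prop :=
  ∃ a b : ℝ, a < b ∧ IndepFunFinWith f a b

/-- The independence number of a family of real functions: the supremum of the
lengths of independent finite sequences in the family. -/
noncomputable def indFun {X : Type*} (F : Set (X → ℝ)) : ℕ∞ :=
  ⨆ (k : ℕ) (_ : ∃ f : Fin k → X → ℝ, (∀ i, f i ∈ F) ∧ IndepFunFin f), (k : ℕ∞)

/-- An infinite sequence of real functions is independent. -/
def IndepFunSeq {X : Type*} (f : ℕ → X → ℝ) : Prop :=
  ∃ a b : ℝ, a < b ∧ ∀ P M : Finset ℕ, Disjoint P M →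
    ((⋂ i ∈ P, {x | f i x ≤ a}) ∩ ⋂ j ∈ M, {x | b ≤ f j x}).Nonempty

/-- A finite set `S` is shattered by a family of sets `𝒟`. -/
def Shatters {Y : Type*} (𝒟 : Set (Set Y)) (S : Finset Y) : Prop :=
  ∀ T : Set Y, T ⊆ ↑S → ∃ D ∈ 𝒟, D ∩ ↑S = T

/-- The VC-dimension of a family of sets. -/
noncomputable def vcDim {Y : Type*} (𝒟 : Set (Set Y)) : ℕ∞ :=
  ⨆ (k : ℕ) (_ : ∃ S : Finset Y, S.card = k ∧ Shatters 𝒟 S), (k : ℕ∞)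

/-- The dual set system of `𝒞`: on the ground set `𝒞`, the sets
`R_x = {C ∈ 𝒞 | x ∈ C}` for `x ∈ X`. -/
def dualSystem {X : Type*} (𝒞 : Set (Set X)) : Set (Set ↥𝒞) :=
  {R | ∃ x : X, R = {C : ↥𝒞 | x ∈ (C : Set X)}}

/-- The family of all continuous median-preserving maps `X → [0,1]`. -/
def MCfam {X : Type*} [TopologicalSpace X] (M : MedianStruct X) : Set (X → ℝ) :=
  {f | Continuous f ∧ IsMedianPreserving M f ∧ ∀ x, f x ∈ Set.Icc (0 : ℝ) 1}

namespace MedianStruct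

variable {X : Type*} {M : MedianStruct X}

theorem med_swap_left (M : MedianStruct X) (x y z : X) : M.med y x z = M.med x y z :=
  M.med_perm (Equiv.swap 0 1) ![x, y, z]

theorem med_swap_right (M : MedianStruct X) (x y z : X) : M.med x z y = M.med x y z :=
  M.med_perm (Equiv.swap 1 2) ![x, y, z]

theorem med_rotate (M : MedianStruct X) (x y z : X) : M.med y z x = M.med x y z := by
  rw [M.med_swap_right, M.med_swap_left]

theorem med_mem_interval (M : MedianStruct X) (x y z : X) : M.med x y z ∈ M.interval x y := by
  have h := M.med_assoc z x y x y
  rw [M.med_rotate y x x, M.med_idem, M.med_swap_left x y y, M.med_idem,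
    ← M.med_rotate z x y] at h
  rw [interval, mem_ofPred_eq, M.med_rotate]
  exact h

theorem isConvex_univ (M : MedianStruct X) : M.IsConvex univ :=
  fun _ _ _ _ => subset_univ _

theorem IsConvex.inter {A B : Set X} (hA : M.IsConvex A) (hB : M.IsConvex B) :
    M.IsConvex (A ∩ B) :=
  fun x hx y hy => subset_inter (hA x hx.1 y hy.1) (hB x hx.2 y hy.2)

/-- The Helly property for three convex sets of a median algebra. -/
theorem IsConvex.inter_inter_nonempty {A B C : Set X} (hA : M.IsConvex A) (hB : M.IsConvex B)
    (hC : M.IsConvex C) (hAB : (A ∩ B).Nonempty) (hBC : (B ∩ C).Nonempty)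
    (hAC : (A ∩ C).Nonempty) : (A ∩ B ∩ C).Nonempty := by
  obtain ⟨x, hxA, hxB⟩ := hAB
  obtain ⟨y, hyB, hyC⟩ := hBC
  obtain ⟨z, hzA, hzC⟩ := hAC
  refine ⟨M.med x y z, ⟨hA z hzA x hxA ?_, hB x hxB y hyB (M.med_mem_interval x y z)⟩,
    hC y hyC z hzC ?_⟩
  · rw [M.med_rotate z x y]
    exact M.med_mem_interval z x y
  · rw [← M.med_rotate x y z]
    exact M.med_mem_interval y z x

/-- The Helly property for finite families of convex sets of a median algebra, relative to a
convex set `D` meeting all members of the family. -/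
theorem IsConvex.inter_biInter_nonempty {ι : Type*} {C : ι → Set X} {D : Set X} {s : Finset ι}
    (hD : M.IsConvex D) (hD' : D.Nonempty) (hC : ∀ i ∈ s, M.IsConvex (C i))
    (hDC : ∀ i ∈ s, (D ∩ C i).Nonempty)
    (hCC : (s : Set ι).Pairwise fun i j => (C i ∩ C j).Nonempty) :
    (D ∩ ⋂ i ∈ s, C i).Nonempty := by
  classical
  induction s using Finset.induction_on generalizing D with
  | empty => simpa using hD'
  | insert i s hi ih =>
    have his := Finset.mem_insert_self i s
    have hsub : ∀ j ∈ s, j ∈ insert i s := fun j => Finset.mem_insert_of_mem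
    rw [Finset.set_biInter_insert, ← inter_assoc]
    refine ih (hD.inter (hC i his)) (hDC i his) (fun j hj => hC j (hsub j hj))
      (fun j hj => ?_) (hCC.mono fun j hj => hsub j hj)
    exact hD.inter_inter_nonempty (hC i his) (hC j (hsub j hj)) (hDC i his)
      (hCC his (hsub j hj) fun h => hi (h ▸ hj)) (hDC j (hsub j hj))

/-- Pairwise crossing halfspaces of a median algebra are independent. -/
theorem biInter_inter_biInter_compl_nonempty {ι : Type*} [Nontrivial ι] {A : ι → Set X}
    (hA : ∀ i, M.IsHalfspace (A i)) (hcross : Pairwise fun i j => Crossing (A i) (A j))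
    {P Q : Finset ι} (hPQ : Disjoint P Q) :
    ((⋂ i ∈ P, A i) ∩ ⋂ j ∈ Q, (A j)ᶜ).Nonempty := by
  classical
  let C : ι → Set X := fun i => if i ∈ P then A i else (A i)ᶜ
  have hconv : ∀ i, M.IsConvex (C i) := fun i => by
    by_cases h : i ∈ P <;> simp only [C, h, if_true, if_false]
    exacts [(hA i).1, (hA i).2]
  have hpair : Pairwise fun i j => (C i ∩ C j).Nonempty := fun i j hij => by
    obtain ⟨h₁, h₂, h₃, h₄⟩ := hcross hij
    by_cases hi : i ∈ P <;> by_cases hj : j ∈ P <;> simpa only [C, hi, hj, if_true, if_false]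
  have hCne : ∀ i, (C i).Nonempty := fun i => by
    obtain ⟨j, hj⟩ := exists_ne i
    exact (hpair hj).right
  have : Nonempty X := (hCne (Classical.arbitrary ι)).to_type
  obtain ⟨x, -, hx⟩ := M.isConvex_univ.inter_biInter_nonempty (s := P ∪ Q) univ_nonempty
    (fun i _ => hconv i) (fun i _ => by simpa using hCne i) (hpair.set_pairwise _)
  rw [mem_iInter₂] at hx
  refine ⟨x, mem_iInter₂.2 fun i hi => ?_, mem_iInter₂.2 fun j hj => ?_⟩
  · simpa [C, hi] using hx i (Finset.mem_union_left _ hi)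
  · simpa [C, Finset.disjoint_right.1 hPQ hj] using hx j (Finset.mem_union_right _ hj)

end MedianStruct

/-- Two distinct members of an independent family of sets are crossing. -/
theorem crossing_of_indep {X ι : Type*} {A : ι → Set X}
    (hA : ∀ P Q : Finset ι, Disjoint P Q → ((⋂ i ∈ P, A i) ∩ ⋂ j ∈ Q, (A j)ᶜ).Nonempty)
    {i j : ι} (hij : i ≠ j) : Crossing (A i) (A j) := by
  classical
  refine ⟨?_, ?_, ?_, ?_⟩
  · simpa using hA {i, j} ∅ (by simp)
  · simpa using hA {i} {j} (by simpa using hij)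
  · simpa [inter_comm] using hA {j} {i} (by simpa using hij.symm)
  · simpa using hA ∅ {i, j} (by simp)

/-- a median algebra has subinfinite rank (every family of
pairwise crossing halfspaces is finite) iff there is no infinite sequence of
halfspaces all of whose finite subfamilies are independent. -/
theorem subinfinite_rank_iff_no_infinite_indep_halfspaces {X : Type*}
    (M : MedianStruct X) :
    (∀ 𝒜 : Set (Set X), (∀ A ∈ 𝒜, M.IsHalfspace A) →
      𝒜.Pairwise Crossing → 𝒜.Finite) ↔
    ¬ ∃ A : ℕ → Set X, (∀ n, M.IsHalfspace (A n)) ∧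
        ∀ P Q : Finset ℕ, Disjoint P Q →
          ((⋂ i ∈ P, A i) ∩ ⋂ j ∈ Q, (A j)ᶜ).Nonempty := by
  constructor
  · rintro h ⟨A, hA, hind⟩
    have hcross : Pairwise fun i j => Crossing (A i) (A j) := fun i j => crossing_of_indep hind
    have hinj : Function.Injective A := fun i j hij => by
      by_contra hne
      obtain ⟨x, hx, hx'⟩ := (hcross hne).2.1
      exact hx' (hij ▸ hx)
    refine infinite_range_of_injective hinj (h (range A) (forall_mem_range.2 hA) ?_)
    rintro _ ⟨i, rfl⟩ _ ⟨j, rfl⟩ hij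
    exact hcross fun h => hij (congrArg A h)
  · intro h 𝒜 h𝒜 hcross
    by_contra hinf
    let e := Set.Infinite.natEmbedding 𝒜 hinf
    have hcr : Pairwise fun i j => Crossing (e i : Set X) (e j) := fun i j hij =>
      hcross (e i).2 (e j).2 fun h => hij (e.injective (Subtype.ext h))
    exact h ⟨fun n => e n, fun n => h𝒜 _ (e n).2, fun P Q hPQ =>
      MedianStruct.biInter_inter_biInter_compl_nonempty (fun n => h𝒜 _ (e n).2) hcr hPQ⟩
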